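/- Let d ≥ 3 and for y ∈ ℤ^d set h_y(x) = h_0(x−y). Then: (i) for every finitely supported u : ℤ^d → ℂ and every y ∈ ℤ^d, the sum Σ_{x∈ℤ^d} Σ_{j=1}^d ( u(x+1_j) − u(x) ) · conj( h_y(x+1_j) − h_y(x) ) converges absolutely and equals u(y) (the reproducing property of the Green function for the Dirichlet form); and (ii) for all y, y₁ ∈ ℤ^d the sum Σ_{x∈ℤ^d} Σ_{j=1}^d ( h_y(x+1_j) − h_y(x) ) · ( h_{y₁}(x+1_j) − h_{y₁}(x) ) converges absolutely and equals h_0(y − y₁); in particular Q_0[h_y] = μ² for every y. -/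

import Mathlib

open scoped ENNReal NNReal Topology
open Filter MeasureTheory

noncomputable section

/-- The lattice point `1_j` in `ℤ^d`: `j`-th coordinate `1`, all others `0`. -/
def latUnit (d : ℕ) (j : Fin d) : Fin d → ℤ := fun i => if i = j then 1 else 0

/-- The discrete Dirichlet form `Q_0[u] = Σ_x Σ_j |u(x+1_j) − u(x)|²`, valued in `[0,∞]`. -/
def Q0 {d : ℕ} (u : (Fin d → ℤ) → ℂ) : ℝ≥0∞ :=
  ∑' x : Fin d → ℤ, ∑ j : Fin d, ((‖u (x + latUnit d j) - u x‖₊ : ℝ≥0∞)) ^ 2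

/-- `b_V[u] = Σ_x V(x)|u(x)|²`, valued in `[0,∞]`. -/
def bV {d : ℕ} (V : (Fin d → ℤ) → ℝ) (u : (Fin d → ℤ) → ℂ) : ℝ≥0∞ :=
  ∑' x : Fin d → ℤ, ENNReal.ofReal (V x) * ((‖u x‖₊ : ℝ≥0∞)) ^ 2

/-- The Euclidean norm `|x|` of a lattice point. -/
def znorm {d : ℕ} (x : Fin d → ℤ) : ℝ := Real.sqrt (∑ i, ((x i : ℝ)) ^ 2)

/-- The symbol `ω(z) = 4 Σ_j sin²(z_j/2)` of `−Δ`. -/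
def omegaSym (d : ℕ) (z : Fin d → ℝ) : ℝ := 4 * ∑ j, Real.sin (z j / 2) ^ 2

/-- The box `[−π,π]^d`. -/
def torusBox (d : ℕ) : Set (Fin d → ℝ) :=
  Set.univ.pi fun _ : Fin d => Set.Icc (-Real.pi) Real.pi

/-- The Green function `h_0(x) = (2π)^{−d} ∫_{[−π,π]^d} e^{i x·z}/ω(z) dz` (a priori
complex-valued). -/
def greenC (d : ℕ) (x : Fin d → ℤ) : ℂ :=
  ((2 * Real.pi) ^ d)⁻¹ •
    ∫ z in torusBox d,
      Complex.exp (Complex.I * (((∑ j, (x j : ℝ) * z j : ℝ)) : ℂ)) / ((omegaSym d z : ℝ) : ℂ)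

/-- The Green function, as a real-valued function. -/
def green (d : ℕ) (x : Fin d → ℤ) : ℝ := (greenC d x).re

/-- `μ² = (2π)^{−d} ∫_{[−π,π]^d} dz/ω(z)`. -/
def muSq (d : ℕ) : ℝ := ((2 * Real.pi) ^ d)⁻¹ * ∫ z in torusBox d, (omegaSym d z)⁻¹

open scoped ComplexConjugate
open scoped Pointwise
open UnitAddTorus

attribute [local instance] instMeasureSpaceUnitAddCircle instIsAddHaarMeasureUnitAddCircleVolume

local instance : IsProbabilityMeasure (volume : Measure UnitAddCircle) :=
  inferInstanceAs (IsProbabilityMeasure AddCircle.haarAddCircle)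

theorem UnitAddCircle.measurePreserving_coe (a : ℝ) :
    MeasurePreserving ((↑) : ℝ → UnitAddCircle) (volume.restrict (Set.Ioc a (a + 1))) volume := by
  have h := AddCircle.measurePreserving_mk (1 : ℝ) a
  rw [AddCircle.volume_eq_smul_haarAddCircle] at h
  rw [ENNReal.ofReal_one, one_smul] at h
  exact h

local instance : NullSingletonClass (volume : Measure UnitAddCircle) := by
  refine ⟨fun x => ?_⟩
  obtain ⟨s, rfl⟩ := QuotientAddGroup.mk_surjective x
  have h := UnitAddCircle.measurePreserving_coe 0
  rw [← h.measure_preimage (measurableSet_singleton _).nullMeasurableSet]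
  refine (Set.Countable.mono (fun y hy => ?_)
    (Set.countable_range fun n : ℤ => s + n)).measure_zero _
  have hy' : ((y - s : ℝ) : UnitAddCircle) = 0 := by
    rw [AddCircle.coe_sub, sub_eq_zero]
    exact hy
  obtain ⟨n, hn⟩ := (AddCircle.coe_eq_zero_iff (1 : ℝ)).mp hy'
  exact ⟨n, by simpa using eq_sub_iff_add_eq'.mp hn⟩

theorem UnitAddTorus.hasSum_conj_mFourierCoeff_mul {ι : Type*} [Fintype ι]
    {f g : UnitAddTorus ι → ℂ} (hf : MemLp f 2) (hg : MemLp g 2) :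
    HasSum (fun n => conj (mFourierCoeff f n) * mFourierCoeff g n) (∫ t, conj (f t) * g t) := by
  have h := hasSum_prod_mFourierCoeff hf.toLp hg.toLp
  have key : ∀ {φ : UnitAddTorus ι → ℂ} (hφ : MemLp φ 2) (n : ι → ℤ),
      mFourierCoeff hφ.toLp n = mFourierCoeff φ n := fun hφ n =>
    integral_congr_ae (hφ.coeFn_toLp.mono fun t ht => by simp only [ht])
  simp only [key] at h
  convert! h using 1
  refine integral_congr_ae ?_
  filter_upwards [hf.coeFn_toLp, hg.coeFn_toLp] with t h₁ h₂
  rw [h₁, h₂]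

theorem UnitAddTorus.norm_mFourier_apply {ι : Type*} [Fintype ι] (n : ι → ℤ) (t : UnitAddTorus ι) :
    ‖mFourier n t‖ = 1 := by
  simp only [mFourier, ContinuousMap.coe_mk, norm_prod, fourier_apply, Circle.norm_coe,
    Finset.prod_const_one]

theorem UnitAddTorus.integral_mFourier {ι : Type*} [Fintype ι] [DecidableEq ι] (n : ι → ℤ) :
    ∫ t, mFourier n t = if n = 0 then 1 else 0 := by
  have h := orthonormal_iff_ite.mp (orthonormal_mFourier (d := ι)) 0 n
  simpa [ContinuousMap.inner_toLp, mFourier_zero, eq_comm] using h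

theorem UnitAddTorus.integral_comp_two_pi {d : ℕ} {E : Type*} [NormedAddCommGroup E]
    [NormedSpace ℝ E] (F : UnitAddTorus (Fin d) → E) :
    ((2 * Real.pi) ^ d)⁻¹ •
        ∫ z in torusBox d, F (fun j => ((z j / (2 * Real.pi) : ℝ) : UnitAddCircle))
      = ∫ t, F t := by
  have hpi := Real.pi_pos
  rw [integral_preimage F (fun _ => -(1 / 2))]
  have h := Measure.setIntegral_comp_smul_of_pos (volume : Measure (Fin d → ℝ))
    (fun z => F (fun j => ((z j / (2 * Real.pi) : ℝ) : UnitAddCircle)))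
    {x : Fin d → ℝ | ∀ i, x i ∈ Set.Ioc (-(1 / 2) : ℝ) (-(1 / 2) + 1)} (R := 2 * Real.pi)
    (by positivity)
  simp only [Pi.smul_apply, smul_eq_mul, Module.finrank_fin_fun] at h
  have h2 : ∀ x : ℝ, 2 * Real.pi * x / (2 * Real.pi) = x := fun x => by field_simp
  simp only [h2] at h
  rw [h]
  congr 1
  have hset : (2 * Real.pi) • {x : Fin d → ℝ | ∀ i, x i ∈ Set.Ioc (-(1 / 2) : ℝ) (-(1 / 2) + 1)}
      = Set.univ.pi fun _ : Fin d => Set.Ioc (-Real.pi) Real.pi := by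
    ext x
    rw [Set.mem_smul_set_iff_inv_smul_mem₀ (by positivity)]
    simp only [Set.mem_ofPred_eq, Set.mem_univ_pi, Pi.smul_apply, smul_eq_mul, Set.mem_Ioc,
      inv_mul_eq_div]
    refine forall_congr' fun i => and_congr ?_ ?_
    · rw [lt_div_iff₀ (by positivity)]
      constructor <;> intro h <;> linarith
    · rw [div_le_iff₀ (by positivity)]
      constructor <;> intro h <;> linarith
  rw [hset]
  refine setIntegral_congr_set ?_
  rw [torusBox, volume_pi]
  exact Measure.pi_Ioc_ae_eq_pi_Icc.symm

/-- The symbol of the negative lattice Laplacian, as a function on the unit torus. -/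
def latticeSymbol (d : ℕ) (t : UnitAddTorus (Fin d)) : ℝ :=
  ∑ j, ‖mFourier (latUnit d j) t - 1‖ ^ 2

theorem latUnit_eq_single (d : ℕ) (j : Fin d) : latUnit d j = Pi.single j 1 := by
  ext i
  simp [latUnit, Pi.single_apply]

theorem mFourier_div_two_pi {d : ℕ} (x : Fin d → ℤ) (z : Fin d → ℝ) :
    mFourier x (fun j => ((z j / (2 * Real.pi) : ℝ) : UnitAddCircle))
      = Complex.exp (Complex.I * ((∑ j, (x j : ℝ) * z j : ℝ) : ℂ)) := by
  simp only [mFourier, ContinuousMap.coe_mk, fourier_coe_apply, ← Complex.exp_sum]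
  congr 1
  push_cast
  rw [Finset.mul_sum]
  refine Finset.sum_congr rfl fun j _ => ?_
  have : (Real.pi : ℂ) ≠ 0 := by exact_mod_cast Real.pi_ne_zero
  field_simp

theorem latticeSymbol_div_two_pi {d : ℕ} (z : Fin d → ℝ) :
    latticeSymbol d (fun j => ((z j / (2 * Real.pi) : ℝ) : UnitAddCircle)) = omegaSym d z := by
  simp only [latticeSymbol, omegaSym, mFourier_div_two_pi]
  rw [Finset.mul_sum]
  refine Finset.sum_congr rfl fun j _ => ?_
  have : ∑ i, (latUnit d j i : ℝ) * z i = z j := by simp [latUnit]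
  rw [this, Complex.norm_exp_I_mul_ofReal_sub_one, Real.norm_eq_abs, sq_abs]
  ring

theorem continuous_latticeSymbol (d : ℕ) : Continuous (latticeSymbol d) := by
  unfold latticeSymbol
  fun_prop

theorem mFourier_neg_apply {ι : Type*} [Fintype ι] (n : ι → ℤ) (t : UnitAddTorus ι) :
    mFourier n (-t) = mFourier (-n) t := by
  simp [mFourier, fourier_apply]

theorem latticeSymbol_neg {d : ℕ} (t : UnitAddTorus (Fin d)) :
    latticeSymbol d (-t) = latticeSymbol d t := by
  refine Finset.sum_congr rfl fun j _ => ?_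
  rw [mFourier_neg_apply, mFourier_neg, ← Complex.norm_conj, map_sub, Complex.conj_conj, map_one]

theorem greenC_eq_integral (d : ℕ) (x : Fin d → ℤ) :
    greenC d x = ∫ t, mFourier x t / (latticeSymbol d t : ℂ) := by
  rw [greenC, ← integral_comp_two_pi]
  simp only [mFourier_div_two_pi, latticeSymbol_div_two_pi]

theorem muSq_eq_integral (d : ℕ) : muSq d = ∫ t, (latticeSymbol d t)⁻¹ := by
  rw [muSq, ← integral_comp_two_pi]
  simp only [latticeSymbol_div_two_pi, smul_eq_mul]

theorem greenC_neg (d : ℕ) (x : Fin d → ℤ) : greenC d (-x) = greenC d x := by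
  have : Measure.IsNegInvariant (volume : Measure UnitAddCircle) := inferInstance
  have : Measure.IsNegInvariant (volume : Measure (UnitAddTorus (Fin d))) :=
    Measure.pi.isNegInvariant _
  rw [greenC_eq_integral, greenC_eq_integral, ← integral_neg_eq_self]
  simp only [mFourier_neg_apply, latticeSymbol_neg, neg_neg]

theorem conj_greenC (d : ℕ) (x : Fin d → ℤ) : conj (greenC d x) = greenC d (-x) := by
  rw [greenC_eq_integral, greenC_eq_integral, ← integral_conj]
  simp only [map_div₀, Complex.conj_ofReal, mFourier_neg]

theorem ofReal_green (d : ℕ) (x : Fin d → ℤ) : (green d x : ℂ) = greenC d x :=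
  Complex.conj_eq_iff_re.mp (by rw [conj_greenC, greenC_neg])

theorem green_neg (d : ℕ) (x : Fin d → ℤ) : green d (-x) = green d x := by
  rw [green, greenC_neg, green]

theorem green_zero (d : ℕ) : green d 0 = muSq d := by
  rw [← Complex.ofReal_inj, ofReal_green, greenC_eq_integral, muSq_eq_integral,
    ← integral_complex_ofReal]
  simp [mFourier_zero]

theorem four_mul_abs_le_norm_fourier_one_sub_one {s : ℝ} (hs : |s| ≤ 1 / 2) :
    4 * |s| ≤ ‖(fourier 1 (s : UnitAddCircle) : ℂ) - 1‖ := by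
  have hpi := Real.pi_pos
  have h : (fourier 1 (s : UnitAddCircle) : ℂ)
      = Complex.exp (Complex.I * ((2 * Real.pi * s : ℝ) : ℂ)) := by
    rw [fourier_coe_apply]
    congr 1
    push_cast
    ring
  rw [h, Complex.norm_exp_I_mul_ofReal_sub_one, Real.norm_eq_abs, abs_mul, abs_two]
  have hb := Real.mul_abs_le_abs_sin (x := 2 * Real.pi * s / 2) (by
    rw [show 2 * Real.pi * s / 2 = Real.pi * s by ring, abs_mul, abs_of_pos hpi]
    nlinarith)
  have he : 2 / Real.pi * |2 * Real.pi * s / 2| = 2 * |s| := by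
    rw [show 2 * Real.pi * s / 2 = Real.pi * s by ring, abs_mul, abs_of_pos hpi]
    field_simp
  linarith

theorem integrable_norm_fourier_one_sub_one_rpow {r : ℝ} (hr : -1 < r) (hr' : r < 0) :
    Integrable (fun t : UnitAddCircle => ‖(fourier 1 t : ℂ) - 1‖ ^ r) := by
  have hmeas : Measurable (fun t : UnitAddCircle => ‖(fourier 1 t : ℂ) - 1‖ ^ r) := by
    have : Measurable (fun t : UnitAddCircle => ‖(fourier 1 t : ℂ) - 1‖) :=
      Continuous.measurable (by fun_prop)
    exact this.pow_const r
  rw [← (UnitAddCircle.measurePreserving_coe (-(1 / 2))).integrable_comp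
    hmeas.aestronglyMeasurable]
  have habs : IntervalIntegrable (fun s : ℝ => |s| ^ r) volume (-(1 / 2)) (-(1 / 2) + 1) := by
    refine intervalIntegrable_of_even (fun s => by rw [abs_neg]) (fun s hs => ?_)
    refine (intervalIntegral.intervalIntegrable_rpow' hr).congr ?_
    intro u hu
    rw [Set.uIoc_of_le hs.le] at hu
    simp only [abs_of_pos hu.1]
  rw [intervalIntegrable_iff_integrableOn_Ioc_of_le (by norm_num)] at habs
  refine (habs.const_mul ((4 : ℝ) ^ r)).mono'
    (hmeas.comp AddCircle.measurable_mk').aestronglyMeasurable ?_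
  have hne : ∀ᵐ s : ℝ ∂volume.restrict (Set.Ioc (-(1 / 2) : ℝ) (-(1 / 2) + 1)), s ≠ 0 :=
    ae_restrict_of_ae (Measure.ae_ne volume 0)
  filter_upwards [hne, ae_restrict_mem measurableSet_Ioc] with s hs hs'
  have hpos : 0 < 4 * |s| := by positivity
  rw [Function.comp_apply, Real.norm_of_nonneg (by positivity),
    ← Real.mul_rpow (by norm_num) (abs_nonneg s)]
  refine Real.rpow_le_rpow_of_nonpos hpos (four_mul_abs_le_norm_fourier_one_sub_one ?_) hr'.le
  rw [abs_le]
  constructor <;> linarith [hs'.1, hs'.2]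

theorem ae_forall_norm_mFourier_latUnit_sub_one_pos (d : ℕ) :
    ∀ᵐ t : UnitAddTorus (Fin d), ∀ j, 0 < ‖mFourier (latUnit d j) t - 1‖ := by
  rw [ae_all_iff]
  intro j
  filter_upwards [Measure.ae_eval_ne (μ := fun _ : Fin d => (volume : Measure UnitAddCircle)) j 0]
    with t ht
  rw [norm_pos_iff, sub_ne_zero, latUnit_eq_single, mFourier_single, fourier_one]
  intro h
  exact ht (AddCircle.injective_toCircle one_ne_zero (by
    rw [AddCircle.toCircle_zero]
    exact Subtype.coe_injective h))

theorem ae_latticeSymbol_pos {d : ℕ} (hd : 0 < d) :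
    ∀ᵐ t : UnitAddTorus (Fin d), 0 < latticeSymbol d t := by
  have : Nonempty (Fin d) := ⟨⟨0, hd⟩⟩
  filter_upwards [ae_forall_norm_mFourier_latUnit_sub_one_pos d] with t ht
  exact Finset.sum_pos (fun j _ => pow_pos (ht j) 2) Finset.univ_nonempty

theorem integrable_inv_latticeSymbol {d : ℕ} (hd : 3 ≤ d) :
    Integrable (fun t => (latticeSymbol d t)⁻¹) := by
  have hd0 : (0 : ℝ) < d := by exact_mod_cast (by omega : 0 < d)
  have hd3 : (3 : ℝ) ≤ d := by exact_mod_cast hd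
  have hprod : Integrable (fun t : UnitAddTorus (Fin d) =>
      ∏ j, ‖(fourier 1 (t j) : ℂ) - 1‖ ^ (-(2 / d) : ℝ)) := by
    refine Integrable.fintype_prod (μ := fun _ => (volume : Measure UnitAddCircle)) fun j =>
      integrable_norm_fourier_one_sub_one_rpow ?_ ?_
    · rw [neg_lt_neg_iff, div_lt_one hd0]
      linarith
    · rw [neg_lt_zero]
      positivity
  refine hprod.mono' (continuous_latticeSymbol d).measurable.inv.aestronglyMeasurable ?_
  filter_upwards [ae_forall_norm_mFourier_latUnit_sub_one_pos d, ae_latticeSymbol_pos (by omega)]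
    with t ht hpos
  rw [Real.norm_of_nonneg (inv_nonneg.mpr hpos.le)]
  simp only [latUnit_eq_single, mFourier_single] at ht
  have ham := Real.geom_mean_le_arith_mean_weighted Finset.univ (fun _ : Fin d => (1 / d : ℝ))
    (fun j => ‖(fourier 1 (t j) : ℂ) - 1‖ ^ 2) (fun _ _ => by positivity)
    (by simp [hd0.ne']) (fun _ _ => by positivity)
  have hle : ∏ j, ‖(fourier 1 (t j) : ℂ) - 1‖ ^ (2 / d : ℝ) ≤ latticeSymbol d t := by
    calc ∏ j, ‖(fourier 1 (t j) : ℂ) - 1‖ ^ (2 / d : ℝ)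
        = ∏ j, (‖(fourier 1 (t j) : ℂ) - 1‖ ^ 2) ^ (1 / d : ℝ) := by
          refine Finset.prod_congr rfl fun j _ => ?_
          rw [← Real.rpow_natCast, ← Real.rpow_mul (norm_nonneg _)]
          congr 1
          push_cast
          ring
      _ ≤ ∑ j, (1 / d : ℝ) * ‖(fourier 1 (t j) : ℂ) - 1‖ ^ 2 := ham
      _ ≤ latticeSymbol d t := by
          refine Finset.sum_le_sum fun j _ => ?_
          rw [latUnit_eq_single, mFourier_single]
          refine mul_le_of_le_one_left (sq_nonneg _) ?_
          rw [div_le_one hd0]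
          linarith
  simp only [Real.rpow_neg (norm_nonneg _), Finset.prod_inv_distrib]
  exact inv_anti₀ (Finset.prod_pos fun j _ => Real.rpow_pos_of_pos (ht j) _) hle

theorem integrable_mFourier_mul {ι : Type*} [Fintype ι] {φ : UnitAddTorus ι → ℂ}
    (hφ : Integrable φ) (n : ι → ℤ) : Integrable (fun t => mFourier n t * φ t) :=
  hφ.bdd_mul (mFourier n).continuous.aestronglyMeasurable
    (ae_of_all _ fun t => (norm_mFourier_apply n t).le)

/-- Parseval's identity for the polarized Dirichlet form. -/
theorem hasSum_dirichlet_form {d : ℕ} {φ ψ : UnitAddTorus (Fin d) → ℂ}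
    (hφ : Integrable φ) (hψ : Integrable ψ)
    (hφ₂ : ∀ j, MemLp (fun t => (mFourier (latUnit d j) t - 1) * φ t) 2)
    (hψ₂ : ∀ j, MemLp (fun t => (mFourier (latUnit d j) t - 1) * ψ t) 2) :
    HasSum (fun x : Fin d → ℤ => ∑ j,
        ((∫ t, mFourier (x + latUnit d j) t * φ t) - ∫ t, mFourier x t * φ t) *
          conj ((∫ t, mFourier (x + latUnit d j) t * ψ t) - ∫ t, mFourier x t * ψ t))
      (∫ t, (latticeSymbol d t : ℂ) * (φ t * conj (ψ t))) := by
  have hcoeff : ∀ {f : UnitAddTorus (Fin d) → ℂ} (_ : Integrable f) (x : Fin d → ℤ) (j : Fin d),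
      mFourierCoeff (fun t => (mFourier (latUnit d j) t - 1) * f t) (-x)
        = (∫ t, mFourier (x + latUnit d j) t * f t) - ∫ t, mFourier x t * f t := by
    intro f hf x j
    rw [← integral_sub (integrable_mFourier_mul hf _) (integrable_mFourier_mul hf _), mFourierCoeff]
    refine integral_congr_ae (ae_of_all _ fun t => ?_)
    simp only [neg_neg, smul_eq_mul, mFourier_add]
    ring
  have hj : ∀ j, HasSum (fun x : Fin d → ℤ =>
      ((∫ t, mFourier (x + latUnit d j) t * φ t) - ∫ t, mFourier x t * φ t) *
        conj ((∫ t, mFourier (x + latUnit d j) t * ψ t) - ∫ t, mFourier x t * ψ t))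
      (∫ t, conj ((mFourier (latUnit d j) t - 1) * ψ t) *
        ((mFourier (latUnit d j) t - 1) * φ t)) := by
    intro j
    have h := (Equiv.neg (Fin d → ℤ)).hasSum_iff.mpr
      (hasSum_conj_mFourierCoeff_mul (hψ₂ j) (hφ₂ j))
    refine h.congr_fun fun x => ?_
    simp only [Function.comp_apply, Equiv.neg_apply, hcoeff hφ, hcoeff hψ]
    ring
  convert! hasSum_sum fun j (_ : j ∈ Finset.univ) => hj j using 1
  have hintegrable : ∀ j ∈ Finset.univ, Integrable fun t =>
      conj ((mFourier (latUnit d j) t - 1) * ψ t) * ((mFourier (latUnit d j) t - 1) * φ t) :=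
    fun j _ => (hψ₂ j).star.integrable_mul (hφ₂ j)
  rw [← integral_finsetSum _ hintegrable]
  refine integral_congr_ae (ae_of_all _ fun t => ?_)
  simp only [latticeSymbol, Complex.ofReal_sum, Finset.sum_mul]
  refine Finset.sum_congr rfl fun j _ => ?_
  rw [Complex.ofReal_pow, ← Complex.mul_conj', map_mul]
  ring

theorem integral_mFourier_mul_greenSymbol (d : ℕ) (x y : Fin d → ℤ) :
    ∫ t, mFourier x t * (mFourier (-y) t / (latticeSymbol d t : ℂ)) = greenC d (x - y) := by
  rw [greenC_eq_integral]
  simp only [sub_eq_add_neg, mFourier_add, mul_div_assoc]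

theorem integrable_greenSymbol {d : ℕ} (hd : 3 ≤ d) (y : Fin d → ℤ) :
    Integrable (fun t => mFourier (-y) t / (latticeSymbol d t : ℂ)) := by
  have h : Integrable fun t => (latticeSymbol d t : ℂ)⁻¹ :=
    (integrable_inv_latticeSymbol hd).ofReal.congr (ae_of_all _ fun t => Complex.ofReal_inv _)
  simpa only [div_eq_mul_inv] using integrable_mFourier_mul h (-y)

theorem memLp_gradient_greenSymbol {d : ℕ} (hd : 3 ≤ d) (y : Fin d → ℤ) (j : Fin d) :
    MemLp (fun t => (mFourier (latUnit d j) t - 1) *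
      (mFourier (-y) t / (latticeSymbol d t : ℂ))) 2 := by
  have hmeas : AEStronglyMeasurable (fun t => (mFourier (latUnit d j) t - 1) *
      (mFourier (-y) t / (latticeSymbol d t : ℂ))) volume :=
    (((mFourier (latUnit d j)).continuous.sub
      continuous_const).aestronglyMeasurable).mul
        (integrable_greenSymbol hd y).aestronglyMeasurable
  rw [memLp_two_iff_integrable_sq_norm hmeas]
  refine (integrable_inv_latticeSymbol hd).mono' (hmeas.norm.pow 2) ?_
  filter_upwards [ae_latticeSymbol_pos (d := d) (by omega)] with t ht
  have hle : ‖mFourier (latUnit d j) t - 1‖ ^ 2 ≤ latticeSymbol d t :=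
    Finset.single_le_sum (f := fun j => ‖mFourier (latUnit d j) t - 1‖ ^ 2)
      (fun _ _ => sq_nonneg _) (Finset.mem_univ j)
  rw [Real.norm_of_nonneg (sq_nonneg _), norm_mul, norm_div, norm_mFourier_apply,
    Complex.norm_real, Real.norm_of_nonneg ht.le, mul_pow, div_pow, one_pow, mul_one_div,
    div_le_iff₀ (pow_pos ht 2), pow_two (latticeSymbol d t), inv_mul_cancel_left₀ ht.ne']
  exact hle

theorem integral_mFourier_mul_sum {d : ℕ} (u : (Fin d → ℤ) → ℂ)
    {s : Finset (Fin d → ℤ)} (hs : Function.support u ⊆ s) (x : Fin d → ℤ) :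
    ∫ t, mFourier x t * ∑ a ∈ s, u a * mFourier (-a) t = u x := by
  have h : ∀ t : UnitAddTorus (Fin d), mFourier x t * ∑ a ∈ s, u a * mFourier (-a) t
      = ∑ a ∈ s, u a * mFourier (x - a) t := by
    intro t
    rw [Finset.mul_sum]
    refine Finset.sum_congr rfl fun a _ => ?_
    rw [sub_eq_add_neg, mFourier_add]
    ring
  simp only [h]
  rw [integral_finsetSum _ fun a _ => Continuous.integrable_of_hasCompactSupport (by fun_prop)
    (HasCompactSupport.of_compactSpace _)]
  simp only [integral_const_mul, integral_mFourier, sub_eq_zero, mul_ite, mul_one, mul_zero]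
  rw [Finset.sum_ite_eq s x u]
  split_ifs with hx
  · rfl
  · by_contra hux
    exact hx (hs (Ne.symm hux))

theorem hasSum_dirichlet_form_green_left {d : ℕ} (hd : 3 ≤ d) (y : Fin d → ℤ)
    {u : (Fin d → ℤ) → ℂ} (hu : (Function.support u).Finite) :
    HasSum (fun x : Fin d → ℤ => ∑ j, (u (x + latUnit d j) - u x) *
      conj ((green d (x + latUnit d j - y) : ℂ) - (green d (x - y) : ℂ))) (u y) := by
  obtain ⟨s, hs⟩ : ∃ s : Finset (Fin d → ℤ), Function.support u ⊆ s :=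
    ⟨hu.toFinset, by simp⟩
  have hcont : Continuous fun t : UnitAddTorus (Fin d) => ∑ a ∈ s, u a * mFourier (-a) t := by
    fun_prop
  have h := hasSum_dirichlet_form
    (hcont.integrable_of_hasCompactSupport (HasCompactSupport.of_compactSpace _))
    (integrable_greenSymbol hd y)
    (fun j => Continuous.memLp_of_hasCompactSupport (by fun_prop)
      (HasCompactSupport.of_compactSpace _))
    (memLp_gradient_greenSymbol hd y)
  simp only [integral_mFourier_mul_greenSymbol, integral_mFourier_mul_sum u hs] at h
  simp only [ofReal_green]
  convert! h using 1
  rw [← integral_mFourier_mul_sum u hs y]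
  refine integral_congr_ae ?_
  filter_upwards [ae_latticeSymbol_pos (d := d) (by omega)] with t ht
  have hne : (latticeSymbol d t : ℂ) ≠ 0 := by exact_mod_cast ht.ne'
  rw [map_div₀, Complex.conj_ofReal, ← mFourier_neg, neg_neg]
  field_simp

theorem hasSum_dirichlet_form_green {d : ℕ} (hd : 3 ≤ d) (y y₁ : Fin d → ℤ) :
    HasSum (fun x : Fin d → ℤ => ∑ j,
      (green d (x + latUnit d j - y) - green d (x - y)) *
        (green d (x + latUnit d j - y₁) - green d (x - y₁))) (green d (y - y₁)) := by
  have h := hasSum_dirichlet_form (integrable_greenSymbol hd y) (integrable_greenSymbol hd y₁)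
    (memLp_gradient_greenSymbol hd y) (memLp_gradient_greenSymbol hd y₁)
  simp only [integral_mFourier_mul_greenSymbol, ← ofReal_green, ← Complex.ofReal_sub,
    Complex.conj_ofReal, ← Complex.ofReal_mul, ← Complex.ofReal_sum] at h
  rw [← Complex.hasSum_ofReal]
  convert! h using 1
  rw [← green_neg, neg_sub, ofReal_green, ← integral_mFourier_mul_greenSymbol]
  refine integral_congr_ae ?_
  filter_upwards [ae_latticeSymbol_pos (d := d) (by omega)] with t ht
  have hne : (latticeSymbol d t : ℂ) ≠ 0 := by exact_mod_cast ht.ne'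
  rw [map_div₀, Complex.conj_ofReal, ← mFourier_neg, neg_neg]
  field_simp

theorem Q0_green {d : ℕ} (hd : 3 ≤ d) (y : Fin d → ℤ) :
    Q0 (fun x => (green d (x - y) : ℂ)) = ENNReal.ofReal (muSq d) := by
  have h := hasSum_dirichlet_form_green hd y y
  rw [sub_self, green_zero] at h
  rw [← h.tsum_eq, ENNReal.ofReal_tsum_of_nonneg
    (fun x => Finset.sum_nonneg fun j _ => mul_self_nonneg _) h.summable, Q0]
  refine tsum_congr fun x => ?_
  rw [ENNReal.ofReal_sum_of_nonneg fun j _ => mul_self_nonneg _]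
  refine Finset.sum_congr rfl fun j _ => ?_
  rw [← Complex.ofReal_sub, Complex.nnnorm_real, ← enorm_eq_nnnorm, ← ofReal_norm,
    ← ENNReal.ofReal_pow (norm_nonneg _), Real.norm_eq_abs, sq_abs, pow_two]

/-- the reproducing property of the Green functions `h_y(x) = h_0(x−y)`
for the discrete Dirichlet form, their mutual energy products, and `Q_0[h_y] = μ²`. -/
theorem green_function_reproducing (d : ℕ) (hd : 3 ≤ d) (y y₁ : Fin d → ℤ) :
    (∀ u : (Fin d → ℤ) → ℂ, (Function.support u).Finite →
      Summable (fun x : Fin d → ℤ => ∑ j : Fin d,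
        (u (x + latUnit d j) - u x) *
          (starRingEnd ℂ)
            (((green d (x + latUnit d j - y) : ℝ) : ℂ) - ((green d (x - y) : ℝ) : ℂ))) ∧
      (∑' x : Fin d → ℤ, ∑ j : Fin d,
        (u (x + latUnit d j) - u x) *
          (starRingEnd ℂ)
            (((green d (x + latUnit d j - y) : ℝ) : ℂ) - ((green d (x - y) : ℝ) : ℂ)))
        = u y) ∧
    Summable (fun x : Fin d → ℤ => ∑ j : Fin d,
      (green d (x + latUnit d j - y) - green d (x - y)) *
        (green d (x + latUnit d j - y₁) - green d (x - y₁))) ∧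
    (∑' x : Fin d → ℤ, ∑ j : Fin d,
      (green d (x + latUnit d j - y) - green d (x - y)) *
        (green d (x + latUnit d j - y₁) - green d (x - y₁))) = green d (y - y₁) ∧
    Q0 (fun x => ((green d (x - y) : ℝ) : ℂ)) = ENNReal.ofReal (muSq d) := by
  exact ⟨fun u hu =>
      have h := hasSum_dirichlet_form_green_left hd y hu
      ⟨h.summable, h.tsum_eq⟩,
    (hasSum_dirichlet_form_green hd y y₁).summable, (hasSum_dirichlet_form_green hd y y₁).tsum_eq,
    Q0_green hd y⟩
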